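/- arXiv:1705.11120 — 2 statements merged into one kernel-verified Lean document; each statement's English description precedes it below -/
import Mathlib

section
/- Let r ≠ 0 and a₀, a be real numbers. There exist a constant C > 0 and an integer N such that for every integer n ≥ N, every complex root s of the cubic equation (n s − a₀)(s² + r²) − a s = 0 satisfies |Re s| ≤ C/n. (The three roots are asymptotically s = O(1/n) and s = ± i r + O(1/n).) -/
/-- For `r ≠ 0` there exist `C > 0` and `N` such that for every `n ≥ N`, every
complex root `s` of the cubic `(n s − a₀)(s² + r²) − a s = 0` satisfies
`|Re s| ≤ C/n` (the three roots are asymptotically `O(1/n)` and `± i r + O(1/n)`). -/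
theorem cubic_roots_real_part_O_inv_n (r a₀ a : ℝ) (hr : r ≠ 0) :
    ∃ C : ℝ, 0 < C ∧ ∃ N : ℕ, ∀ n : ℕ, N ≤ n → ∀ s : ℂ,
      ((n : ℂ) * s - (a₀ : ℂ)) * (s ^ 2 + (r : ℂ) ^ 2) - (a : ℂ) * s = 0 →
      |s.re| ≤ C / (n : ℝ) := by
  have hρ : 0 < |r| := abs_pos.mpr hr
  refine ⟨|a₀| + 4 * |a| / |r| + 1, by positivity, 1, fun n hn s hs => ?_⟩
  have hn0 : (0 : ℝ) < n := by exact_mod_cast hn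
  have hxt : |s.re| ≤ ‖s‖ := Complex.abs_re_le_norm s
  have hnr : ‖(r : ℂ) ^ 2‖ = |r| ^ 2 := by simp
  have h1 : ‖s‖ ^ 2 ≤ ‖s ^ 2 + (r : ℂ) ^ 2‖ + |r| ^ 2 := by
    have := norm_sub_le (s ^ 2 + (r : ℂ) ^ 2) ((r : ℂ) ^ 2)
    rwa [add_sub_cancel_right, hnr, norm_pow] at this
  have h2 : |r| ^ 2 ≤ ‖s ^ 2 + (r : ℂ) ^ 2‖ + ‖s‖ ^ 2 := by
    have := norm_sub_le (s ^ 2 + (r : ℂ) ^ 2) (s ^ 2)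
    rwa [add_sub_cancel_left, hnr, norm_pow] at this
  have h3 : |s.re| * |r| ≤ ‖s ^ 2 + (r : ℂ) ^ 2‖ := by
    rw [← abs_mul]
    refine abs_le_of_sq_le_sq ?_ (norm_nonneg _)
    rw [← Complex.normSq_eq_norm_sq, Complex.normSq_apply]
    simp only [pow_two, Complex.add_re, Complex.add_im, Complex.mul_re, Complex.mul_im,
      Complex.ofReal_re, Complex.ofReal_im]
    nlinarith [sq_nonneg (s.re ^ 2), sq_nonneg (s.im ^ 2 - r ^ 2), sq_nonneg (s.re * r),
      sq_nonneg (s.re * s.im)]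
  have h4 : n * ‖s‖ * ‖s ^ 2 + (r : ℂ) ^ 2‖ ≤ |a₀| * ‖s ^ 2 + (r : ℂ) ^ 2‖ + |a| * ‖s‖ := by
    have e : (n : ℂ) * s * (s ^ 2 + (r : ℂ) ^ 2)
        = (a₀ : ℂ) * (s ^ 2 + (r : ℂ) ^ 2) + (a : ℂ) * s := by
      linear_combination hs
    have := norm_add_le ((a₀ : ℂ) * (s ^ 2 + (r : ℂ) ^ 2)) ((a : ℂ) * s)
    rw [← e] at this
    simpa only [norm_mul, Complex.norm_natCast, Complex.norm_real, Real.norm_eq_abs] using this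
  have hA := abs_nonneg a₀
  have hB := abs_nonneg a
  have hx := abs_nonneg s.re
  have ht := norm_nonneg s
  have hq := norm_nonneg (s ^ 2 + (r : ℂ) ^ 2)
  generalize ‖s ^ 2 + (r : ℂ) ^ 2‖ = q at *
  generalize ‖s‖ = t at *
  generalize |s.re| = x at *
  generalize |a₀| = A at *
  generalize |a| = B at *
  generalize |r| = ρ at *
  have key : n * x * ρ ≤ A * ρ + 4 * B := by
    by_cases hc : ρ ^ 2 / 2 ≤ q
    · have hq0 : 0 < q := lt_of_lt_of_le (by positivity) hc
      have htr : t * ρ ≤ 4 * q := by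
        refine abs_le_of_sq_le_sq' ?_ (by positivity) |>.2
        nlinarith [mul_le_mul_of_nonneg_right h1 (sq_nonneg ρ), mul_le_mul_of_nonneg_left hc hq,
          mul_le_mul_of_nonneg_left hc (sq_nonneg ρ)]
      have : n * t * ρ ≤ A * ρ + 4 * B := by
        refine le_of_mul_le_mul_right ?_ hq0
        nlinarith [mul_le_mul_of_nonneg_right h4 hρ.le, mul_le_mul_of_nonneg_left htr hB]
      have : n * x * ρ ≤ n * t * ρ := by gcongr
      linarith
    · push Not at hc
      have htρ : ρ / 2 ≤ t := by
        by_contra! h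
        nlinarith
      have ht0 : 0 < t := by linarith
      have hqt : q ≤ ρ * t := by nlinarith
      have : n * q ≤ A * ρ + B := by
        refine le_of_mul_le_mul_right ?_ ht0
        nlinarith [mul_le_mul_of_nonneg_left hqt hA]
      nlinarith [mul_le_mul_of_nonneg_left h3 hn0.le]
  rw [le_div_iff₀ hn0]
  have : x * n ≤ (A * ρ + 4 * B) / ρ := by
    rw [le_div_iff₀ hρ]; linarith
  have e : (A * ρ + 4 * B) / ρ = A + 4 * B / ρ := by field_simp
  linarith
end

section
/- Let ρ > 0, c > 0, a > 0 and a₀ ∈ ℝ. There exists an integer N such that for every integer n ≥ N the equation ρ s (n s − a₀) = a √(1 + s²/c²) has a real solution s_n > 0, and the solutions can be chosen so that √n · s_n → √(a/ρ) as n → ∞; in particular n · s_n → ∞. -/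
open Filter

/-- For `ρ > 0`, `c > 0`, `a > 0` and `a₀ ∈ ℝ`, there exists `N` such that for every
`n ≥ N` the equation `ρ s (n s − a₀) = a √(1 + s²/c²)` has a real solution `s_n > 0`,
and the solutions can be chosen so that `√n · s_n → √(a/ρ)`; in particular
`n · s_n → ∞`. -/
theorem compressible_root_family_exists (ρ c a a₀ : ℝ)
    (hρ : 0 < ρ) (hc : 0 < c) (ha : 0 < a) :
    ∃ (N : ℕ) (s : ℕ → ℝ),
      (∀ n : ℕ, N ≤ n → 0 < s n ∧
        ρ * s n * ((n : ℝ) * s n - a₀) = a * Real.sqrt (1 + s n ^ 2 / c ^ 2))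
      ∧ Tendsto (fun n : ℕ => Real.sqrt (n : ℝ) * s n) atTop (nhds (Real.sqrt (a / ρ)))
      ∧ Tendsto (fun n : ℕ => (n : ℝ) * s n) atTop atTop := by
  set T : ℝ := Real.sqrt (a / ρ) + 1 with hT
  have hq : Real.sqrt (a / ρ) ^ 2 = a / ρ := Real.sq_sqrt (by positivity)
  have hq0 : 0 < Real.sqrt (a / ρ) := Real.sqrt_pos.mpr (by positivity)
  have hTpos : 0 < T := by positivity
  have hsq : Tendsto (fun n : ℕ => Real.sqrt (n : ℝ)) atTop atTop :=
    Real.tendsto_sqrt_atTop.comp tendsto_natCast_atTop_atTop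
  have he : Tendsto (fun n : ℕ => (Real.sqrt (n : ℝ))⁻¹) atTop (nhds 0) :=
    hsq.inv_tendsto_atTop
  have hlim : Tendsto (fun n : ℕ => ρ * T * (T - (Real.sqrt (n : ℝ))⁻¹ * a₀)
      - a * Real.sqrt (1 + ((Real.sqrt (n : ℝ))⁻¹ * T) ^ 2 / c ^ 2)) atTop
      (nhds (ρ * T * T - a)) := by
    have hcont : Continuous (fun e : ℝ => ρ * T * (T - e * a₀)
      - a * Real.sqrt (1 + (e * T) ^ 2 / c ^ 2)) := by fun_prop
    have := (hcont.tendsto 0).comp he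
    simpa [Function.comp_def] using this
  have hpos : 0 < ρ * T * T - a := by
    have h1 : ρ * (a / ρ) = a := by field_simp
    have h2 : ρ * T * T - a = ρ * (2 * Real.sqrt (a / ρ) + 1) := by
      rw [hT]
      linear_combination ρ * hq + h1
    rw [h2]
    positivity
  obtain ⟨N, hN⟩ := eventually_atTop.mp (hlim.eventually (lt_mem_nhds hpos))
  have hex : ∀ n : ℕ, ∃ t : ℝ, N ≤ n → 0 < t ∧ t ≤ T ∧
      ρ * t * (t - (Real.sqrt (n : ℝ))⁻¹ * a₀)
      - a * Real.sqrt (1 + ((Real.sqrt (n : ℝ))⁻¹ * t) ^ 2 / c ^ 2) = 0 := by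
    intro n
    by_cases hn : N ≤ n
    · have hcont : Continuous (fun t : ℝ => ρ * t * (t - (Real.sqrt (n : ℝ))⁻¹ * a₀)
        - a * Real.sqrt (1 + ((Real.sqrt (n : ℝ))⁻¹ * t) ^ 2 / c ^ 2)) := by fun_prop
      have := intermediate_value_Icc hTpos.le hcont.continuousOn
      obtain ⟨t, ht, h0⟩ := this (show (0 : ℝ) ∈ _ from ⟨by simp [ha.le], (hN n hn).le⟩)
      refine ⟨t, fun _ => ⟨lt_of_le_of_ne ht.1 ?_, ht.2, h0⟩⟩
      rintro rfl
      simp at h0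
      exact ha.ne' h0
    · exact ⟨0, fun h => absurd h hn⟩
  choose t ht using hex
  have hev : ∀ᶠ n : ℕ in atTop, max N 1 ≤ n := eventually_ge_atTop _
  have het : Tendsto (fun n : ℕ => (Real.sqrt (n : ℝ))⁻¹ * t n) atTop (nhds 0) := by
    have hup : Tendsto (fun n : ℕ => (Real.sqrt (n : ℝ))⁻¹ * T) atTop (nhds 0) := by
      simpa using he.mul_const T
    refine tendsto_of_tendsto_of_tendsto_of_le_of_le' tendsto_const_nhds hup ?_ ?_
    · filter_upwards [hev] with n hn
      have := (ht n (le_of_max_le_left hn)).1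
      positivity
    · filter_upwards [hev] with n hn
      have := (ht n (le_of_max_le_left hn)).2.1
      gcongr
  have htlim : Tendsto t atTop (nhds (Real.sqrt (a / ρ))) := by
    have hcont : Continuous (fun x : ℝ =>
        Real.sqrt ((a * Real.sqrt (1 + x ^ 2 / c ^ 2) + ρ * a₀ * x) / ρ)) := by fun_prop
    have h1 := (hcont.tendsto 0).comp het
    simp only [ne_eq, OfNat.ofNat_ne_zero, not_false_eq_true, zero_pow, zero_div, add_zero,
      Real.sqrt_one, mul_one, mul_zero] at h1
    refine h1.congr' ?_
    filter_upwards [hev] with n hn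
    obtain ⟨h0, -, h2⟩ := ht n (le_of_max_le_left hn)
    have h3 : (a * Real.sqrt (1 + ((Real.sqrt (n : ℝ))⁻¹ * t n) ^ 2 / c ^ 2)
        + ρ * a₀ * ((Real.sqrt (n : ℝ))⁻¹ * t n)) / ρ = t n ^ 2 := by
      rw [div_eq_iff hρ.ne']
      linear_combination -h2
    simp only [Function.comp]
    rw [h3, Real.sqrt_sq h0.le]
  have hlim2 : Tendsto (fun n : ℕ => Real.sqrt (n : ℝ) * ((Real.sqrt (n : ℝ))⁻¹ * t n)) atTop
      (nhds (Real.sqrt (a / ρ))) := by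
    refine htlim.congr' ?_
    filter_upwards [hev] with n hn
    have hn1 : 0 < n := le_of_max_le_right hn
    have : 0 < Real.sqrt (n : ℝ) := Real.sqrt_pos.mpr (by exact_mod_cast hn1)
    field_simp
  refine ⟨max N 1, fun n => (Real.sqrt (n : ℝ))⁻¹ * t n, ?_, hlim2, ?_⟩
  · intro n hn
    obtain ⟨h0, -, h2⟩ := ht n (le_of_max_le_left hn)
    have hn1 : 0 < n := le_of_max_le_right hn
    have hr : 0 < Real.sqrt (n : ℝ) := Real.sqrt_pos.mpr (by exact_mod_cast hn1)
    refine ⟨by positivity, ?_⟩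
    have hs : (n : ℝ) = Real.sqrt n * Real.sqrt n := (Real.mul_self_sqrt (by positivity)).symm
    have hi : Real.sqrt (n : ℝ) * (Real.sqrt (n : ℝ))⁻¹ = 1 := mul_inv_cancel₀ hr.ne'
    have hk : (n : ℝ) * (Real.sqrt (n : ℝ))⁻¹ * (Real.sqrt (n : ℝ))⁻¹ = 1 := by
      calc (n : ℝ) * (Real.sqrt (n : ℝ))⁻¹ * (Real.sqrt (n : ℝ))⁻¹
          = (Real.sqrt n * Real.sqrt n) * (Real.sqrt (n : ℝ))⁻¹ * (Real.sqrt (n : ℝ))⁻¹ := by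
            rw [← hs]
        _ = (Real.sqrt (n : ℝ) * (Real.sqrt (n : ℝ))⁻¹) ^ 2 := by ring
        _ = 1 := by rw [hi]; norm_num
    linear_combination h2 + ρ * t n ^ 2 * hk
  · refine (hsq.atTop_mul_pos hq0 hlim2).congr fun n => ?_
    rw [← mul_assoc, Real.mul_self_sqrt (by positivity)]
end
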